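/- arXiv:2605.01816 — 3 statements merged into one kernel-verified Lean document; each statement's English description precedes it below -/
import Mathlib

section
/- Let X1 and X2 be Polish spaces and c : X1 × X2 → [0,+∞] a lower semicontinuous cost function. Then the optimal transport cost C : P(X1) × P(X2) → [0,+∞], defined by C(μ1,μ2) := min { ∫ c dπ : π ∈ Γ(μ1,μ2) }, is lower semicontinuous with respect to the product of the narrow topologies. -/
open MeasureTheory Topology ENNReal Set

noncomputable section

namespace OTRM

variable {X1 X2 : Type*}
  [MeasurableSpace X1] [TopologicalSpace X1] [BorelSpace X1] [PolishSpace X1]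
  [MeasurableSpace X2] [TopologicalSpace X2] [BorelSpace X2] [PolishSpace X2]

/-- The set of couplings (transport plans) between two probability measures. -/
def Coupling {Y1 Y2 : Type*} [MeasurableSpace Y1] [MeasurableSpace Y2]
    (μ1 : ProbabilityMeasure Y1) (μ2 : ProbabilityMeasure Y2) :
    Set (ProbabilityMeasure (Y1 × Y2)) :=
  {π | (π : Measure (Y1 × Y2)).map Prod.fst = (μ1 : Measure Y1) ∧
       (π : Measure (Y1 × Y2)).map Prod.snd = (μ2 : Measure Y2)}

/-- The total transport cost of a plan `π` for the cost function `c`. -/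
def transportCost (c : X1 × X2 → ℝ≥0∞) (π : ProbabilityMeasure (X1 × X2)) : ℝ≥0∞ :=
  ∫⁻ p, c p ∂(π : Measure (X1 × X2))

/-- The optimal transport cost `C(μ1, μ2)` associated to the cost `c` (for lower
semicontinuous `c` the infimum is attained, so this is the minimum of the paper). -/
def OTCost (c : X1 × X2 → ℝ≥0∞) (μ1 : ProbabilityMeasure X1) (μ2 : ProbabilityMeasure X2) :
    ℝ≥0∞ :=
  ⨅ π ∈ Coupling μ1 μ2, transportCost c π

/-- Integrals of bounded-below lower semicontinuous functions are lower semicontinuous along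
narrowly convergent sequences. -/
lemma lintegral_le_liminf_of_lsc {Ω : Type*} [MeasurableSpace Ω] [TopologicalSpace Ω]
    [OpensMeasurableSpace Ω] [HasOuterApproxClosed Ω] (f : Ω → ℝ≥0∞) (hf : LowerSemicontinuous f)
    (μ : ProbabilityMeasure Ω) (μs : ℕ → ProbabilityMeasure Ω)
    (h : Filter.Tendsto μs Filter.atTop (𝓝 μ)) :
    ∫⁻ x, f x ∂(μ : Measure Ω) ≤
      Filter.atTop.liminf (fun i => ∫⁻ x, f x ∂(μs i : Measure Ω)) := by
  have hfm : Measurable f := hf.measurable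
  have key : ∀ N : ℕ, ∫⁻ x, min (f x) N ∂(μ : Measure Ω) ≤
      Filter.atTop.liminf (fun i => ∫⁻ x, f x ∂(μs i : Measure Ω)) := by
    intro N
    have hne : ∀ x, min (f x) (N : ℝ≥0∞) ≠ ∞ := fun x =>
      ne_top_of_le_ne_top (ENNReal.natCast_ne_top N) (min_le_right _ _)
    have hrep : ∀ ν : Measure Ω, ∫⁻ x, min (f x) N ∂ν =
        ∫⁻ t in Ioi (0 : ℝ), ν {a | t < (min (f a) (N : ℝ≥0∞)).toReal} := by
      intro ν
      rw [← lintegral_eq_lintegral_meas_lt ν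
        (Filter.Eventually.of_forall fun x => ENNReal.toReal_nonneg)
        (hfm.min measurable_const).ennreal_toReal.aemeasurable]
      simp only [ENNReal.ofReal_toReal (hne _)]
    have hopen : ∀ t : ℝ, 0 < t → IsOpen {a | t < (min (f a) (N : ℝ≥0∞)).toReal} := by
      intro t ht
      have : {a | t < (min (f a) (N : ℝ≥0∞)).toReal} =
          f ⁻¹' Ioi (ENNReal.ofReal t) ∩ {_a | ENNReal.ofReal t < N} := by
        ext a
        simp only [mem_ofPred_eq, mem_inter_iff, mem_preimage, mem_Ioi]
        rw [← ENNReal.ofReal_lt_iff_lt_toReal ht.le (hne a), lt_min_iff]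
      rw [this]
      exact (lowerSemicontinuous_iff_isOpen_preimage.1 hf _).inter isOpen_const
    calc ∫⁻ x, min (f x) N ∂(μ : Measure Ω)
        = ∫⁻ t in Ioi (0 : ℝ), (μ : Measure Ω) {a | t < (min (f a) (N : ℝ≥0∞)).toReal} := hrep _
      _ ≤ ∫⁻ t in Ioi (0 : ℝ), Filter.atTop.liminf
            (fun i => (μs i : Measure Ω) {a | t < (min (f a) (N : ℝ≥0∞)).toReal}) := by
          refine setLIntegral_mono' measurableSet_Ioi fun t ht => ?_
          exact ProbabilityMeasure.le_liminf_measure_open_of_tendsto h (hopen t ht)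
      _ ≤ Filter.atTop.liminf (fun i => ∫⁻ t in Ioi (0 : ℝ),
            (μs i : Measure Ω) {a | t < (min (f a) (N : ℝ≥0∞)).toReal}) :=
          lintegral_liminf_le (fun n => Antitone.measurable (fun s t hst =>
            measure_mono (fun ω hω => lt_of_le_of_lt hst hω)))
      _ = Filter.atTop.liminf (fun i => ∫⁻ x, min (f x) N ∂(μs i : Measure Ω)) := by
          simp only [hrep]
      _ ≤ _ := Filter.liminf_le_liminf (Filter.Eventually.of_forall fun i =>
          lintegral_mono fun x => min_le_left _ _)
  have hsup : ∀ x, f x = ⨆ N : ℕ, min (f x) (N : ℝ≥0∞) := by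
    intro x
    have : (⨆ N : ℕ, min (f x) (N : ℝ≥0∞)) = f x ⊓ ⨆ N : ℕ, (N : ℝ≥0∞) := (inf_iSup_eq _ _).symm
    rw [this, ENNReal.iSup_natCast, inf_top_eq]
  calc ∫⁻ x, f x ∂(μ : Measure Ω) = ∫⁻ x, ⨆ N : ℕ, min (f x) (N : ℝ≥0∞) ∂(μ : Measure Ω) :=
        lintegral_congr hsup
    _ = ⨆ N : ℕ, ∫⁻ x, min (f x) (N : ℝ≥0∞) ∂(μ : Measure Ω) :=
        lintegral_iSup (fun N => hfm.min measurable_const) (fun a b hab x =>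
          min_le_min le_rfl (by exact_mod_cast hab))
    _ ≤ _ := iSup_le key

/-- A convergent sequence of probability measures on a Polish space is tight. -/
lemma tight_of_tendsto {Y : Type*} [MeasurableSpace Y] [TopologicalSpace Y] [BorelSpace Y]
    [PolishSpace Y] (μ : ProbabilityMeasure Y) (μs : ℕ → ProbabilityMeasure Y)
    (h : Filter.Tendsto μs Filter.atTop (𝓝 μ)) :
    IsTightMeasureSet {((ν : ProbabilityMeasure Y) : Measure Y) | ν ∈ range μs} := by
  letI := TopologicalSpace.upgradeIsCompletelyMetrizable Y
  apply isTightMeasureSet_of_isCompact_closure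
  exact h.isCompact_insert_range.closure_of_subset (subset_insert _ _)

/-- Lemma 3.1: if `c : X1 × X2 → [0,∞]` is lower semicontinuous, then the
optimal transport cost `C : P(X1) × P(X2) → [0,∞]` is lower semicontinuous with respect to
the product of the narrow (weak) topologies. -/
theorem lowerSemicontinuous_otCost (c : X1 × X2 → ℝ≥0∞) (hc : LowerSemicontinuous c) :
    LowerSemicontinuous
      (fun p : ProbabilityMeasure X1 × ProbabilityMeasure X2 => OTCost c p.1 p.2) := by
  rw [lowerSemicontinuous_iff_isClosed_preimage]
  intro y
  refine IsSeqClosed.isClosed ?_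
  rintro p ⟨μ1, μ2⟩ hp hlim
  have h1 : Filter.Tendsto (fun n => (p n).1) Filter.atTop (𝓝 μ1) :=
    (continuous_fst.tendsto _).comp hlim
  have h2 : Filter.Tendsto (fun n => (p n).2) Filter.atTop (𝓝 μ2) :=
    (continuous_snd.tendsto _).comp hlim
  change OTCost c μ1 μ2 ≤ y
  refine le_of_forall_gt_imp_ge_of_dense fun z hz => ?_
  have hex : ∀ n, ∃ π ∈ Coupling (p n).1 (p n).2, transportCost c π < z := by
    intro n
    have : OTCost c (p n).1 (p n).2 < z := lt_of_le_of_lt (hp n) hz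
    simpa only [OTCost, iInf_lt_iff, exists_prop] using this
  choose π hπ hπz using hex
  have htight : IsTightMeasureSet
      {((ν : ProbabilityMeasure (X1 × X2)) : Measure (X1 × X2)) | ν ∈ range π} := by
    apply IsTightMeasureSet.prodMk
    · refine (tight_of_tendsto μ1 _ h1).subset ?_
      rintro _ ⟨_, ⟨_, ⟨n, rfl⟩, rfl⟩, rfl⟩
      exact ⟨(p n).1, ⟨n, rfl⟩, (hπ n).1.symm⟩
    · refine (tight_of_tendsto μ2 _ h2).subset ?_
      rintro _ ⟨_, ⟨_, ⟨n, rfl⟩, rfl⟩, rfl⟩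
      exact ⟨(p n).2, ⟨n, rfl⟩, (hπ n).2.symm⟩
  obtain ⟨ρ, -, φ, hφ, hρ⟩ := (isCompact_closure_of_isTightMeasureSet htight).tendsto_subseq
    (fun n => subset_closure (mem_range_self n))
  have hcoup : ρ ∈ Coupling μ1 μ2 := by
    constructor
    · have ha := ProbabilityMeasure.tendsto_map_of_tendsto_of_continuous _ _ hρ
        (continuous_fst (X := X1) (Y := X2))
      have hb := h1.comp hφ.tendsto_atTop
      have he : (fun i => ((π ∘ φ) i).map (continuous_fst (X := X1) (Y := X2)).measurable.aemeasurable)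
          = (fun n => (p n).1) ∘ φ := by
        funext n
        exact Subtype.ext (hπ (φ n)).1
      rw [he] at ha
      have hu := tendsto_nhds_unique ha hb
      exact congrArg Subtype.val hu
    · have ha := ProbabilityMeasure.tendsto_map_of_tendsto_of_continuous _ _ hρ
        (continuous_snd (X := X1) (Y := X2))
      have hb := h2.comp hφ.tendsto_atTop
      have he : (fun i => ((π ∘ φ) i).map (continuous_snd (X := X1) (Y := X2)).measurable.aemeasurable)
          = (fun n => (p n).2) ∘ φ := by
        funext n
        exact Subtype.ext (hπ (φ n)).2
      rw [he] at ha
      have hu := tendsto_nhds_unique ha hb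
      exact congrArg Subtype.val hu
  have hcost : transportCost c ρ ≤ z := by
    refine (lintegral_le_liminf_of_lsc c hc ρ _ hρ).trans ?_
    refine Filter.liminf_le_of_frequently_le' ?_
    exact Filter.Frequently.of_forall fun n => (hπz (φ n)).le
  exact (iInf₂_le ρ hcoup).trans hcost

end OTRM
end
end

section
/- Let P ∈ RΓ(M1,M2) be a random coupling and define Π := (pr¹_♯, pr²_♯)_♯ P ∈ P(P(X1) × P(X2)). Then Π ∈ Γ(M1,M2) and ∫ C(μ1,μ2) dΠ(μ1,μ2) ≤ ∫ (∫ c dπ) dP(π). Moreover 𝒞(M1,M2) = min { ∫ (∫ c(x1,x2) dπ(x1,x2)) dP(π) : P ∈ RΓ(M1,M2) }, and this (possibly infinite) minimum is attained. -/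
open MeasureTheory Topology ENNReal Set

noncomputable section

namespace OTRM

noncomputable instance instMSPM {X : Type*} [MeasurableSpace X] [TopologicalSpace X]
    [OpensMeasurableSpace X] : MeasurableSpace (ProbabilityMeasure X) := borel _

instance instBSPM {X : Type*} [MeasurableSpace X] [TopologicalSpace X]
    [OpensMeasurableSpace X] : BorelSpace (ProbabilityMeasure X) := ⟨rfl⟩

variable {X1 X2 : Type*}
  [MeasurableSpace X1] [TopologicalSpace X1] [BorelSpace X1] [PolishSpace X1]
  [MeasurableSpace X2] [TopologicalSpace X2] [BorelSpace X2] [PolishSpace X2]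

/-- First marginal of a transport plan. -/
def margFst (π : ProbabilityMeasure (X1 × X2)) : ProbabilityMeasure X1 :=
  π.map measurable_fst.aemeasurable

/-- Second marginal of a transport plan. -/
def margSnd (π : ProbabilityMeasure (X1 × X2)) : ProbabilityMeasure X2 :=
  π.map measurable_snd.aemeasurable

/-- The iterated optimal transport cost `𝒞(M1, M2)` between laws of random measures. -/
def IterOTCost (c : X1 × X2 → ℝ≥0∞)
    (M1 : ProbabilityMeasure (ProbabilityMeasure X1))
    (M2 : ProbabilityMeasure (ProbabilityMeasure X2)) : ℝ≥0∞ :=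
  ⨅ P ∈ Coupling M1 M2,
    ∫⁻ p, OTCost c p.1 p.2 ∂(P : Measure (ProbabilityMeasure X1 × ProbabilityMeasure X2))

/-- The set of (laws of) random couplings between `M1` and `M2`. -/
def RandCoupling (M1 : ProbabilityMeasure (ProbabilityMeasure X1))
    (M2 : ProbabilityMeasure (ProbabilityMeasure X2)) :
    Set (ProbabilityMeasure (ProbabilityMeasure (X1 × X2))) :=
  {P | (P : Measure (ProbabilityMeasure (X1 × X2))).map margFst
          = (M1 : Measure (ProbabilityMeasure X1)) ∧
       (P : Measure (ProbabilityMeasure (X1 × X2))).map margSnd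
          = (M2 : Measure (ProbabilityMeasure X2))}


/-! ### Lower semicontinuity of integral functionals -/

lemma aux_step (f δ : ℝ≥0∞) (hδ : δ ≠ 0) (hδ' : δ ≠ ∞) :
    (∑' k : ℕ, (if ((k : ℝ≥0∞) + 1) * δ < f then δ else 0)) ≤ f ∧
    f ≤ (∑' k : ℕ, (if ((k : ℝ≥0∞) + 1) * δ < f then δ else 0)) + δ := by
  classical
  by_cases h : ∀ k : ℕ, ((k : ℝ≥0∞) + 1) * δ < f
  · have hf : f = ∞ := by
      by_contra hf
      obtain ⟨n, hn⟩ := ENNReal.exists_nat_gt (ENNReal.div_lt_top hf hδ).ne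
      rw [ENNReal.div_lt_iff (Or.inl hδ) (Or.inl hδ')] at hn
      have := h n
      have h2 : (n : ℝ≥0∞) * δ ≤ ((n : ℝ≥0∞) + 1) * δ := by gcongr; exact le_self_add
      exact absurd (hn.trans_le h2) (not_lt.2 this.le)
    subst hf
    refine ⟨le_top, ?_⟩
    simp only [h, if_true]
    rw [ENNReal.tsum_const_eq_top_of_ne_zero hδ]
    simp
  · push Not at h
    set N := Nat.find h with hN
    have h1 : f ≤ ((N : ℝ≥0∞) + 1) * δ := Nat.find_spec h
    have h2 : ∀ k < N, ((k : ℝ≥0∞) + 1) * δ < f := fun k hk => not_le.1 (Nat.find_min h hk)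
    have h3 : ∀ k, N ≤ k → ¬ ((k : ℝ≥0∞) + 1) * δ < f := fun k hk => by
      rw [not_lt]
      refine h1.trans ?_
      gcongr
    have hS : (∑' k : ℕ, (if ((k : ℝ≥0∞) + 1) * δ < f then δ else 0)) = N * δ := by
      rw [tsum_eq_sum (s := Finset.range N)]
      · rw [Finset.sum_congr rfl (g := fun _ => δ)]
        · simp
        · intro k hk
          rw [if_pos (h2 k (Finset.mem_range.1 hk))]
      · intro k hk
        rw [if_neg (h3 k (by simpa using hk))]
    rw [hS]
    refine ⟨?_, by rw [add_mul, one_mul] at h1; exact h1⟩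
    rcases Nat.eq_zero_or_pos N with h0 | h0
    · simp [h0]
    · have := h2 (N - 1) (by omega)
      have e : (((N - 1 : ℕ) : ℝ≥0∞) + 1) = N := by
        exact_mod_cast congrArg (Nat.cast (R := ℝ≥0∞)) (Nat.sub_add_cancel h0)
      rw [e] at this
      exact this.le

lemma lsc_measure_open {Y : Type*} [MeasurableSpace Y] [TopologicalSpace Y]
    [OpensMeasurableSpace Y] [HasOuterApproxClosed Y] {G : Set Y} (hG : IsOpen G) :
    LowerSemicontinuous (fun μ : ProbabilityMeasure Y => (μ : Measure Y) G) := by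
  rw [lowerSemicontinuous_iff_le_liminf]
  intro μ
  exact ProbabilityMeasure.le_liminf_measure_open_of_tendsto (μs := id) Filter.tendsto_id hG

lemma lsc_lintegral {Y : Type*} [MeasurableSpace Y] [TopologicalSpace Y]
    [OpensMeasurableSpace Y] [HasOuterApproxClosed Y] {f : Y → ℝ≥0∞}
    (hf : LowerSemicontinuous f) :
    LowerSemicontinuous (fun μ : ProbabilityMeasure Y => ∫⁻ y, f y ∂(μ : Measure Y)) := by
  classical
  let δ : ℕ → ℝ≥0∞ := fun n => ((n : ℝ≥0∞) + 1)⁻¹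
  have hδ : ∀ n, δ n ≠ 0 := fun n => by simp [δ]
  have hδ' : ∀ n, δ n ≠ ∞ := fun n => by simp [δ]
  have hopen : ∀ t, IsOpen {y | t < f y} := fun t => hf.isOpen_preimage t
  have hI : ∀ n (μ : ProbabilityMeasure Y),
      ∫⁻ y, (∑' k : ℕ, (if ((k : ℝ≥0∞) + 1) * δ n < f y then δ n else 0)) ∂(μ : Measure Y)
        = ∑' k : ℕ, δ n * (μ : Measure Y) {y | ((k : ℝ≥0∞) + 1) * δ n < f y} := by
    intro n μ
    have e : ∀ k : ℕ, (fun y => if ((k : ℝ≥0∞) + 1) * δ n < f y then δ n else 0)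
        = Set.indicator {y | ((k : ℝ≥0∞) + 1) * δ n < f y} (fun _ => δ n) := by
      intro k
      ext y
      simp [Set.indicator_apply]
    rw [lintegral_tsum]
    · congr 1
      ext k
      rw [e, lintegral_indicator (hopen _).measurableSet]
      simp
    · intro k
      rw [e]
      exact (measurable_const.indicator (hopen _).measurableSet).aemeasurable
  have key : (fun μ : ProbabilityMeasure Y => ∫⁻ y, f y ∂(μ : Measure Y))
      = fun μ : ProbabilityMeasure Y => ⨆ n, ∑' k : ℕ, δ n * (μ : Measure Y) {y | ((k : ℝ≥0∞) + 1) * δ n < f y} := by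
    ext μ
    apply le_antisymm
    · refine ENNReal.le_of_forall_pos_le_add fun ε hε _ => ?_
      obtain ⟨n, hn⟩ := ENNReal.exists_inv_nat_lt (a := (ε : ℝ≥0∞)) (by simpa using hε.ne')
      have hn' : δ n ≤ ε := le_trans (by simp only [δ]; gcongr; exact le_self_add) hn.le
      calc ∫⁻ y, f y ∂(μ : Measure Y)
          ≤ ∫⁻ y, ((∑' k : ℕ, (if ((k : ℝ≥0∞) + 1) * δ n < f y then δ n else 0)) + δ n)
              ∂(μ : Measure Y) :=
            lintegral_mono fun y => (aux_step (f y) (δ n) (hδ n) (hδ' n)).2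
        _ = (∑' k : ℕ, δ n * (μ : Measure Y) {y | ((k : ℝ≥0∞) + 1) * δ n < f y}) + δ n := by
            rw [lintegral_add_right _ measurable_const, hI]; simp
        _ ≤ _ := by
            gcongr
            exact le_iSup (fun n => ∑' k : ℕ, δ n * (μ : Measure Y)
              {y | ((k : ℝ≥0∞) + 1) * δ n < f y}) n
    · refine iSup_le fun n => ?_
      rw [← hI]
      exact lintegral_mono fun y => (aux_step (f y) (δ n) (hδ n) (hδ' n)).1
  rw [key]
  refine lowerSemicontinuous_iSup fun n => lowerSemicontinuous_tsum fun k => ?_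
  exact (ENNReal.continuous_const_mul (hδ' n)).comp_lowerSemicontinuous
    (lsc_measure_open (hopen _)) (fun a b hab => by dsimp only; gcongr)

/-! ### Coercive functionals and tightness -/

lemma isCompact_lintegral_le {Y : Type*} [MeasurableSpace Y] [TopologicalSpace Y]
    [BorelSpace Y] [T2Space Y] [HasOuterApproxClosed Y] {f : Y → ℝ≥0∞}
    (hf : LowerSemicontinuous f) (hK : ∀ R : ℝ≥0∞, R ≠ ∞ → IsCompact {y | f y ≤ R})
    (R : ℝ≥0∞) (hR : R ≠ ∞) :
    IsCompact {μ : ProbabilityMeasure Y | ∫⁻ y, f y ∂(μ : Measure Y) ≤ R} := by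
  have hcl : IsClosed {μ : ProbabilityMeasure Y | ∫⁻ y, f y ∂(μ : Measure Y) ≤ R} :=
    (lsc_lintegral hf).isClosed_preimage R
  rw [← hcl.closure_eq]
  apply isCompact_closure_of_isTightMeasureSet
  rw [isTightMeasureSet_iff_exists_isCompact_measure_compl_le]
  intro ε hε
  by_cases hε' : ε = ∞
  · exact ⟨∅, isCompact_empty, by simp [hε']⟩
  have hA : (R + 1) / ε ≠ ∞ := (ENNReal.div_lt_top (by simp [hR]) hε.ne').ne
  have hA0 : (R + 1) / ε ≠ 0 := by simp [hε']
  refine ⟨_, hK _ hA, ?_⟩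
  rintro _ ⟨μ, hμ, rfl⟩
  calc (μ : Measure Y) {y | f y ≤ (R + 1) / ε}ᶜ
      ≤ (μ : Measure Y) {y | (R + 1) / ε ≤ f y} := by
        apply measure_mono
        intro y hy
        rw [Set.mem_compl_iff, Set.mem_ofPred_eq, not_le] at hy
        exact hy.le
    _ ≤ (∫⁻ y, f y ∂(μ : Measure Y)) / ((R + 1) / ε) :=
        meas_ge_le_lintegral_div hf.measurable.aemeasurable hA0 hA
    _ ≤ (R + 1) / ((R + 1) / ε) := by
        gcongr
        exact le_trans hμ le_self_add
    _ = ε := by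
        rw [ENNReal.div_eq_inv_mul, ENNReal.inv_div (Or.inl hε') (Or.inl hε.ne'),
          ENNReal.div_mul_cancel (by simp) (by simp [hR])]

lemma exists_coercive {X : Type*} [MeasurableSpace X] [TopologicalSpace X] [BorelSpace X]
    [PolishSpace X] (m : Measure X) [IsFiniteMeasure m] :
    ∃ ψ : X → ℝ≥0∞, LowerSemicontinuous ψ ∧ (∀ R : ℝ≥0∞, R ≠ ∞ → IsCompact {x | ψ x ≤ R}) ∧
      ∫⁻ x, ψ x ∂m ≠ ∞ := by
  have ht : IsTightMeasureSet {m} := isTightMeasureSet_singleton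
  rw [isTightMeasureSet_iff_exists_isCompact_measure_compl_le] at ht
  have : ∀ n : ℕ, ∃ K : Set X, IsCompact K ∧ m Kᶜ ≤ 2⁻¹ ^ n := by
    intro n
    obtain ⟨K, h1, h2⟩ := ht (2⁻¹ ^ n) (ENNReal.pow_pos (by simp) n)
    exact ⟨K, h1, h2 m rfl⟩
  choose K hK hm using this
  let ψ : X → ℝ≥0∞ := fun x => ∑' n, (K n)ᶜ.indicator (fun _ => 1) x
  have hψ : LowerSemicontinuous ψ := lowerSemicontinuous_tsum fun n =>
    (hK n).isClosed.isOpen_compl.lowerSemicontinuous_indicator zero_le_one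
  refine ⟨ψ, hψ, ?_, ?_⟩
  · intro R hR
    obtain ⟨N, hN⟩ := ENNReal.exists_nat_gt hR
    refine ((Finset.range N).isCompact_biUnion fun n _ => hK n).of_isClosed_subset
      (hψ.isClosed_preimage R) ?_
    intro x hx
    by_contra hx'
    have hx'' : ∀ n ∈ Finset.range N, x ∉ K n := by
      intro n hn h
      exact hx' (Set.mem_biUnion hn h)
    have : (N : ℝ≥0∞) ≤ ψ x := by
      calc (N : ℝ≥0∞) = ∑ n ∈ Finset.range N, (K n)ᶜ.indicator (fun _ => (1 : ℝ≥0∞)) x := by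
            rw [Finset.sum_congr rfl (g := fun _ => (1 : ℝ≥0∞))]
            · simp
            · intro n hn
              exact Set.indicator_of_mem (hx'' n hn) _
        _ ≤ _ := ENNReal.sum_le_tsum _
    exact absurd (hN.trans_le (this.trans hx)) (lt_irrefl _)
  · have : ∫⁻ x, ψ x ∂m ≤ 2 := by
      rw [← ENNReal.tsum_geometric_two]
      simp only [ψ]
      rw [lintegral_tsum fun n => (measurable_const.indicator
        (hK n).isClosed.isOpen_compl.measurableSet).aemeasurable]
      refine ENNReal.tsum_le_tsum fun n => ?_
      rw [lintegral_indicator (hK n).isClosed.isOpen_compl.measurableSet]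
      simpa using hm n
    exact (this.trans_lt (by simp)).ne

lemma measurable_coe_PM {X : Type*} [MeasurableSpace X] [TopologicalSpace X] [BorelSpace X]
    [HasOuterApproxClosed X] :
    Measurable (fun μ : ProbabilityMeasure X => (μ : Measure X)) := by
  refine Measurable.measure_of_isPiSystem_of_isProbabilityMeasure (S := {s | IsOpen s})
    (BorelSpace.measurable_eq (α := X)) isPiSystem_isOpen ?_
  intro s hs
  exact (lsc_measure_open hs).measurable

/-- A coercive functional on the base space with finite iterated integral. -/
lemma exists_coercive_iter {X : Type*} [MeasurableSpace X] [TopologicalSpace X] [BorelSpace X]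
    [PolishSpace X] (M : ProbabilityMeasure (ProbabilityMeasure X)) :
    ∃ ψ : X → ℝ≥0∞, LowerSemicontinuous ψ ∧ (∀ R : ℝ≥0∞, R ≠ ∞ → IsCompact {x | ψ x ≤ R}) ∧
      ∫⁻ μ, (∫⁻ x, ψ x ∂(μ : Measure X)) ∂(M : Measure (ProbabilityMeasure X)) ≠ ∞ := by
  have hmeas := measurable_coe_PM (X := X)
  have : IsProbabilityMeasure ((M : Measure (ProbabilityMeasure X)).bind
      (fun μ : ProbabilityMeasure X => (μ : Measure X))) :=
    isProbabilityMeasure_bind hmeas.aemeasurable (by filter_upwards with μ; infer_instance)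
  obtain ⟨ψ, h1, h2, h3⟩ := exists_coercive ((M : Measure (ProbabilityMeasure X)).bind
      (fun μ : ProbabilityMeasure X => (μ : Measure X)))
  refine ⟨ψ, h1, h2, ?_⟩
  rwa [Measure.lintegral_bind hmeas.aemeasurable h1.measurable.aemeasurable] at h3

/-! ### Marginals -/

lemma continuous_margFst :
    Continuous (margFst : ProbabilityMeasure (X1 × X2) → ProbabilityMeasure X1) :=
  ProbabilityMeasure.continuous_map continuous_fst

lemma continuous_margSnd :
    Continuous (margSnd : ProbabilityMeasure (X1 × X2) → ProbabilityMeasure X2) :=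
  ProbabilityMeasure.continuous_map continuous_snd

lemma lsc_transportCost {c : X1 × X2 → ℝ≥0∞} (hc : LowerSemicontinuous c) :
    LowerSemicontinuous (transportCost c) :=
  lsc_lintegral hc

lemma OTCost_le (c : X1 × X2 → ℝ≥0∞) (π : ProbabilityMeasure (X1 × X2)) :
    OTCost c (margFst π) (margSnd π) ≤ transportCost c π :=
  iInf₂_le π ⟨rfl, rfl⟩

lemma exists_near_opt (c : X1 × X2 → ℝ≥0∞) {ε : ℝ≥0∞} (hε : ε ≠ 0)
    (y : ProbabilityMeasure X1 × ProbabilityMeasure X2) :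
    ∃ π : ProbabilityMeasure (X1 × X2), margFst π = y.1 ∧ margSnd π = y.2 ∧
      transportCost c π ≤ OTCost c y.1 y.2 + ε := by
  by_cases h : OTCost c y.1 y.2 = ∞
  · refine ⟨y.1.prod y.2, ?_, ?_, by simp [h]⟩
    · exact ProbabilityMeasure.map_fst_prod _ _
    · exact ProbabilityMeasure.map_snd_prod _ _
  · have := ENNReal.lt_add_right h hε
    conv_lhs at this => rw [OTCost]
    simp only [iInf_lt_iff] at this
    obtain ⟨π, hπ, h3⟩ := this
    exact ⟨π, Subtype.ext hπ.1, Subtype.ext hπ.2, h3.le⟩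

lemma exists_reps {Y ι : Type*} [Nonempty Y] (g : Y → ι) (C : Y → ℝ≥0∞) {ε : ℝ≥0∞}
    (hε : ε ≠ 0) : ∃ r : ι → Y, ∀ y, g (r (g y)) = g y ∧ C (r (g y)) ≤ C y + ε := by
  have : ∀ i : ι, ∃ z : Y, ∀ y, g y = i → g z = i ∧ C z ≤ C y + ε := by
    intro i
    by_cases hi : ∃ y, g y = i
    · obtain ⟨y0, hy0⟩ := hi
      by_cases h : (⨅ (y : Y) (_ : g y = i), C y) = ∞
      · refine ⟨y0, fun y hy => ⟨hy0, ?_⟩⟩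
        have : C y = ∞ := top_le_iff.1 (h ▸ iInf₂_le y hy)
        simp [this]
      · have := ENNReal.lt_add_right h hε
        obtain ⟨z, hz⟩ := iInf_lt_iff.1 this
        obtain ⟨hz1, hz2⟩ := iInf_lt_iff.1 hz
        refine ⟨z, fun y hy => ⟨hz1, hz2.le.trans ?_⟩⟩
        gcongr
        exact iInf₂_le y hy
    · exact ⟨Classical.arbitrary Y, fun y hy => absurd ⟨y, hy⟩ hi⟩
  choose r hr using this
  exact ⟨r, fun y => hr (g y) y rfl⟩

lemma le_add_one_of_code {a b : ℝ≥0∞} (h1 : (a = ∞) = (b = ∞))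
    (h2 : ⌊a.toReal⌋ = ⌊b.toReal⌋) : a ≤ b + 1 := by
  by_cases hb : b = ∞
  · simp [hb]
  have ha : a ≠ ∞ := fun h => hb (h1 ▸ h)
  have := (abs_lt.1 (Int.abs_sub_lt_one_of_floor_eq_floor h2)).2
  rw [← ENNReal.toReal_le_toReal ha (by simp [hb]), ENNReal.toReal_add hb (by simp)]
  simp
  linarith

/-- Measurable near-optimal selection with countably many values. -/
lemma exists_selection (c : X1 × X2 → ℝ≥0∞) {ψ1 : X1 → ℝ≥0∞} {ψ2 : X2 → ℝ≥0∞}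
    (h1 : LowerSemicontinuous ψ1) (h2 : LowerSemicontinuous ψ2)
    (s1 : Finset (BoundedContinuousFunction (ProbabilityMeasure X1) ℝ))
    (s2 : Finset (BoundedContinuousFunction (ProbabilityMeasure X2) ℝ)) (n : ℕ)
    (hne : Nonempty (ProbabilityMeasure X1 × ProbabilityMeasure X2)) :
    ∃ s : ProbabilityMeasure X1 × ProbabilityMeasure X2 → ProbabilityMeasure (X1 × X2),
      Measurable s ∧
      (∀ y, transportCost c (s y) ≤ OTCost c y.1 y.2 + 2 * ((n : ℝ≥0∞) + 1)⁻¹) ∧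
      (∀ y, ∫⁻ x, ψ1 x ∂(margFst (s y) : Measure X1) ≤ ∫⁻ x, ψ1 x ∂(y.1 : Measure X1) + 1) ∧
      (∀ y, ∫⁻ x, ψ2 x ∂(margSnd (s y) : Measure X2) ≤ ∫⁻ x, ψ2 x ∂(y.2 : Measure X2) + 1) ∧
      (∀ f ∈ s1, ∀ y, |f (margFst (s y)) - f y.1| ≤ ((n : ℝ) + 1)⁻¹) ∧
      (∀ f ∈ s2, ∀ y, |f (margSnd (s y)) - f y.2| ≤ ((n : ℝ) + 1)⁻¹) := by
  classical
  have hε : ((n : ℝ≥0∞) + 1)⁻¹ ≠ 0 := by simp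
  choose κ hκ1 hκ2 hκ3 using exists_near_opt c hε
  let F1 : ProbabilityMeasure X1 → ℝ≥0∞ := fun μ => ∫⁻ x, ψ1 x ∂(μ : Measure X1)
  let F2 : ProbabilityMeasure X2 → ℝ≥0∞ := fun μ => ∫⁻ x, ψ2 x ∂(μ : Measure X2)
  have hF1 : Measurable F1 := (lsc_lintegral h1).measurable
  have hF2 : Measurable F2 := (lsc_lintegral h2).measurable
  let g1 : ProbabilityMeasure X1 → (Prop × ℤ) × (s1 → ℤ) := fun μ =>
    ((F1 μ = ∞, ⌊(F1 μ).toReal⌋), fun f => ⌊((n : ℝ) + 1) * f.1 μ⌋)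
  let g2 : ProbabilityMeasure X2 → (Prop × ℤ) × (s2 → ℤ) := fun μ =>
    ((F2 μ = ∞, ⌊(F2 μ).toReal⌋), fun f => ⌊((n : ℝ) + 1) * f.1 μ⌋)
  have hg1 : Measurable g1 := by
    refine (Measurable.prodMk ?_ hF1.ennreal_toReal.floor).prodMk (measurable_pi_lambda _ ?_)
    · exact measurableSet_setOfPred.1 (hF1 (measurableSet_singleton ∞))
    · intro f
      exact (measurable_const.mul f.1.continuous.measurable).floor
  have hg2 : Measurable g2 := by
    refine (Measurable.prodMk ?_ hF2.ennreal_toReal.floor).prodMk (measurable_pi_lambda _ ?_)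
    · exact measurableSet_setOfPred.1 (hF2 (measurableSet_singleton ∞))
    · intro f
      exact (measurable_const.mul f.1.continuous.measurable).floor
  let g : ProbabilityMeasure X1 × ProbabilityMeasure X2 →
      ((Prop × ℤ) × (s1 → ℤ)) × ((Prop × ℤ) × (s2 → ℤ)) := fun y => (g1 y.1, g2 y.2)
  have hg : Measurable g := (hg1.comp measurable_fst).prodMk (hg2.comp measurable_snd)
  obtain ⟨r, hr⟩ := exists_reps g (fun y => OTCost c y.1 y.2) hε
  have hn : (0 : ℝ) < (n : ℝ) + 1 := by positivity
  have hfl : ∀ a b : ℝ, ⌊((n : ℝ) + 1) * a⌋ = ⌊((n : ℝ) + 1) * b⌋ → |a - b| ≤ ((n : ℝ) + 1)⁻¹ := by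
    intro a b hab
    have := Int.abs_sub_lt_one_of_floor_eq_floor hab
    rw [← mul_sub, abs_mul, abs_of_pos hn] at this
    rw [← one_div, le_div_iff₀ hn, mul_comm]
    exact this.le
  refine ⟨fun y => κ (r (g y)), (measurable_of_countable (fun i => κ (r i))).comp hg,
    ?_, ?_, ?_, ?_, ?_⟩
  · intro y
    refine (hκ3 _).trans ?_
    rw [two_mul, ← add_assoc]
    gcongr
    exact (hr y).2
  · intro y
    rw [hκ1]
    have e : g1 (r (g y)).1 = g1 y.1 := congrArg Prod.fst (hr y).1
    exact le_add_one_of_code (congrArg (fun z => z.1.1) e) (congrArg (fun z => z.1.2) e)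
  · intro y
    rw [hκ2]
    have e : g2 (r (g y)).2 = g2 y.2 := congrArg Prod.snd (hr y).1
    exact le_add_one_of_code (congrArg (fun z => z.1.1) e) (congrArg (fun z => z.1.2) e)
  · intro f hf y
    rw [hκ1]
    have e : g1 (r (g y)).1 = g1 y.1 := congrArg Prod.fst (hr y).1
    exact hfl _ _ (congrArg (fun z => z.2 ⟨f, hf⟩) e)
  · intro f hf y
    rw [hκ2]
    have e : g2 (r (g y)).2 = g2 y.2 := congrArg Prod.snd (hr y).1
    exact hfl _ _ (congrArg (fun z => z.2 ⟨f, hf⟩) e)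

/-! ### Attainment -/

set_option maxHeartbeats 1000000 in
lemma exists_optimal (c : X1 × X2 → ℝ≥0∞) (hc : LowerSemicontinuous c)
    (M1 : ProbabilityMeasure (ProbabilityMeasure X1))
    (M2 : ProbabilityMeasure (ProbabilityMeasure X2)) (hI : IterOTCost c M1 M2 ≠ ∞) :
    ∃ P' ∈ RandCoupling M1 M2,
        (∫⁻ π, transportCost c π ∂(P' : Measure (ProbabilityMeasure (X1 × X2))))
          ≤ IterOTCost c M1 M2 := by
  classical
  obtain ⟨ψ1, h1, hK1, hfin1⟩ := exists_coercive_iter M1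
  obtain ⟨ψ2, h2, hK2, hfin2⟩ := exists_coercive_iter M2
  have hne : Nonempty (ProbabilityMeasure X1 × ProbabilityMeasure X2) :=
    ⟨((M1 : Measure (ProbabilityMeasure X1)).nonempty_of_neZero.some,
      (M2 : Measure (ProbabilityMeasure X2)).nonempty_of_neZero.some)⟩
  -- near optimal couplings
  have hcoup : ∀ n : ℕ, ∃ Q ∈ Coupling M1 M2,
      ∫⁻ p, OTCost c p.1 p.2 ∂(Q : Measure (ProbabilityMeasure X1 × ProbabilityMeasure X2))
        ≤ IterOTCost c M1 M2 + ((n : ℝ≥0∞) + 1)⁻¹ := by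
    intro n
    have := ENNReal.lt_add_right hI (b := ((n : ℝ≥0∞) + 1)⁻¹) (by simp)
    conv_lhs at this => rw [IterOTCost]
    simp only [iInf_lt_iff] at this
    obtain ⟨Q, hQ, h⟩ := this
    exact ⟨Q, hQ, h.le⟩
  choose Q hQ hQI using hcoup
  -- the coercive functional on the product
  let ψ : X1 × X2 → ℝ≥0∞ := fun x => ψ1 x.1 + ψ2 x.2
  have hl1 : LowerSemicontinuous (fun x : X1 × X2 => ψ1 x.1) := h1.comp continuous_fst
  have hl2 : LowerSemicontinuous (fun x : X1 × X2 => ψ2 x.2) := h2.comp continuous_snd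
  have hψ : LowerSemicontinuous ψ := hl1.add hl2
  have hKψ : ∀ R : ℝ≥0∞, R ≠ ∞ → IsCompact {x | ψ x ≤ R} := by
    intro R hR
    refine ((hK1 R hR).prod (hK2 R hR)).of_isClosed_subset (hψ.isClosed_preimage R) ?_
    intro x hx
    have hx' : ψ1 x.1 + ψ2 x.2 ≤ R := hx
    exact ⟨le_self_add.trans hx', le_add_self.trans hx'⟩
  let Ψ : ProbabilityMeasure (X1 × X2) → ℝ≥0∞ := fun π => ∫⁻ x, ψ x ∂(π : Measure (X1 × X2))
  have hΨ : LowerSemicontinuous Ψ := lsc_lintegral hψ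
  have hKΨ : ∀ R : ℝ≥0∞, R ≠ ∞ → IsCompact {π | Ψ π ≤ R} :=
    fun R hR => isCompact_lintegral_le hψ hKψ R hR
  have hΨeq : ∀ π, Ψ π = ∫⁻ x, ψ1 x ∂(margFst π : Measure X1)
      + ∫⁻ x, ψ2 x ∂(margSnd π : Measure X2) := by
    intro π
    have e1 : ∫⁻ x, ψ1 x ∂(margFst π : Measure X1)
        = ∫⁻ x, ψ1 x.1 ∂(π : Measure (X1 × X2)) :=
      lintegral_map h1.measurable measurable_fst
    have e2 : ∫⁻ x, ψ2 x ∂(margSnd π : Measure X2)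
        = ∫⁻ x, ψ2 x.2 ∂(π : Measure (X1 × X2)) :=
      lintegral_map h2.measurable measurable_snd
    rw [e1, e2]
    exact lintegral_add_left hl1.measurable _
  let I1 := ∫⁻ μ, (∫⁻ x, ψ1 x ∂(μ : Measure X1)) ∂(M1 : Measure (ProbabilityMeasure X1))
  let I2 := ∫⁻ μ, (∫⁻ x, ψ2 x ∂(μ : Measure X2)) ∂(M2 : Measure (ProbabilityMeasure X2))
  let B : ℝ≥0∞ := (I1 + 1) + (I2 + 1)
  have hB : B ≠ ∞ := by simp [B, I1, I2, hfin1, hfin2]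
  have hcomp := isCompact_lintegral_le hΨ hKΨ B hB
  -- the net
  let J := Finset (BoundedContinuousFunction (ProbabilityMeasure X1) ℝ) ×
    Finset (BoundedContinuousFunction (ProbabilityMeasure X2) ℝ) × ℕ
  have hsel := fun j : J => exists_selection c h1 h2 j.1 j.2.1 j.2.2 hne
  choose s hs hs1 hs2 hs3 hs4 hs5 using hsel
  let P : J → ProbabilityMeasure (ProbabilityMeasure (X1 × X2)) := fun j =>
    (Q j.2.2).map (hs j).aemeasurable
  have hPm : ∀ j, (P j : Measure (ProbabilityMeasure (X1 × X2)))
      = (Q j.2.2 : Measure (ProbabilityMeasure X1 × ProbabilityMeasure X2)).map (s j) := fun j => rfl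
  have hPB : ∀ j, ∫⁻ π, Ψ π ∂(P j : Measure (ProbabilityMeasure (X1 × X2))) ≤ B := by
    intro j
    have m1 := (lsc_lintegral h1).measurable
    have m2 := (lsc_lintegral h2).measurable
    rw [hPm, lintegral_map hΨ.measurable (hs j)]
    calc ∫⁻ y, Ψ (s j y) ∂(Q j.2.2 : Measure (ProbabilityMeasure X1 × ProbabilityMeasure X2))
        ≤ ∫⁻ y, ((∫⁻ x, ψ1 x ∂(y.1 : Measure X1) + 1) + (∫⁻ x, ψ2 x ∂(y.2 : Measure X2) + 1))
            ∂(Q j.2.2 : Measure (ProbabilityMeasure X1 × ProbabilityMeasure X2)) := by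
          refine lintegral_mono fun y => ?_
          rw [hΨeq]
          exact add_le_add (hs2 j y) (hs3 j y)
      _ = B := by
          have m1c : Measurable (fun y : ProbabilityMeasure X1 × ProbabilityMeasure X2 =>
              ∫⁻ x, ψ1 x ∂(y.1 : Measure X1) + 1) := (m1.comp measurable_fst).add_const 1
          rw [lintegral_add_left m1c,
            lintegral_add_right _ measurable_const, lintegral_add_right _ measurable_const]
          simp only [lintegral_const, measure_univ, mul_one, B, I1, I2]
          rw [← (hQ j.2.2).1, ← (hQ j.2.2).2, lintegral_map m1 measurable_fst,
            lintegral_map m2 measurable_snd]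
  have hPc : ∀ j, ∫⁻ π, transportCost c π ∂(P j : Measure (ProbabilityMeasure (X1 × X2)))
      ≤ IterOTCost c M1 M2 + 3 * ((j.2.2 : ℝ≥0∞) + 1)⁻¹ := by
    intro j
    rw [hPm, lintegral_map (lsc_transportCost hc).measurable (hs j)]
    calc ∫⁻ y, transportCost c (s j y) ∂(Q j.2.2 : Measure (ProbabilityMeasure X1 × ProbabilityMeasure X2))
        ≤ ∫⁻ y, (OTCost c y.1 y.2 + 2 * ((j.2.2 : ℝ≥0∞) + 1)⁻¹) ∂(Q j.2.2 : Measure (ProbabilityMeasure X1 × ProbabilityMeasure X2)) :=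
          lintegral_mono fun y => hs1 j y
      _ = ∫⁻ y, OTCost c y.1 y.2 ∂(Q j.2.2 : Measure (ProbabilityMeasure X1 × ProbabilityMeasure X2)) + 2 * ((j.2.2 : ℝ≥0∞) + 1)⁻¹ := by
          rw [lintegral_add_right _ measurable_const]
          simp
      _ ≤ (IterOTCost c M1 M2 + ((j.2.2 : ℝ≥0∞) + 1)⁻¹) + 2 * ((j.2.2 : ℝ≥0∞) + 1)⁻¹ := by
          gcongr
          exact hQI _
      _ = IterOTCost c M1 M2 + 3 * ((j.2.2 : ℝ≥0∞) + 1)⁻¹ := by ring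
  -- ultrafilter limit
  let U : Ultrafilter J := Ultrafilter.of Filter.atTop
  have hU : (U : Filter J) ≤ Filter.atTop := Ultrafilter.of_le _
  obtain ⟨P', -, hP'⟩ := hcomp.ultrafilter_le_nhds (U.map P) (by
    rw [Filter.le_principal_iff]
    exact Filter.Eventually.of_forall (f := (U : Filter J)) hPB)
  have hlim : Filter.Tendsto P U (𝓝 P') := hP'
  have hN : Filter.Tendsto (fun j : J => j.2.2) Filter.atTop Filter.atTop := by
    rw [Filter.tendsto_atTop]
    intro b
    filter_upwards [Filter.eventually_ge_atTop ((∅, ∅, b) : J)] with j hj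
    exact hj.2.2
  have hnr : Filter.Tendsto (fun j : J => ((j.2.2 : ℝ) + 1)⁻¹) U (𝓝 0) := by
    have := tendsto_one_div_add_atTop_nhds_zero_nat (𝕜 := ℝ)
    simp only [one_div] at this
    exact (this.comp hN).mono_left hU
  -- marginals
  have hmF : Measurable (margFst : ProbabilityMeasure (X1 × X2) → ProbabilityMeasure X1) :=
    continuous_margFst.measurable
  have hmS : Measurable (margSnd : ProbabilityMeasure (X1 × X2) → ProbabilityMeasure X2) :=
    continuous_margSnd.measurable
  have hM1 : Filter.Tendsto (fun j => (P j).map hmF.aemeasurable) U (𝓝 M1) := by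
    rw [ProbabilityMeasure.tendsto_iff_forall_integral_tendsto]
    intro f
    rw [tendsto_iff_norm_sub_tendsto_zero]
    refine squeeze_zero' (Filter.Eventually.of_forall fun _ => norm_nonneg _) ?_ hnr
    have hev : ∀ᶠ j : J in U, f ∈ j.1 := by
      refine hU ?_
      filter_upwards [Filter.eventually_ge_atTop (({f}, ∅, 0) : J)] with j hj
      exact hj.1 (Finset.mem_singleton_self f)
    filter_upwards [hev] with j hj
    have e1 : ∫ μ, f μ ∂((P j).map hmF.aemeasurable : Measure (ProbabilityMeasure X1))
        = ∫ y, f (margFst (s j y)) ∂(Q j.2.2 : Measure (ProbabilityMeasure X1 × ProbabilityMeasure X2)) := by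
      rw [ProbabilityMeasure.toMeasure_map, hPm, Measure.map_map hmF (hs j),
        integral_map (hmF.comp (hs j)).aemeasurable
          f.continuous.measurable.aestronglyMeasurable]
      rfl
    have e2 : ∫ μ, f μ ∂(M1 : Measure (ProbabilityMeasure X1))
        = ∫ y, f y.1 ∂(Q j.2.2 : Measure (ProbabilityMeasure X1 × ProbabilityMeasure X2)) := by
      rw [← (hQ j.2.2).1, integral_map measurable_fst.aemeasurable
          f.continuous.measurable.aestronglyMeasurable]
    have i1 : Integrable (fun y => f (margFst (s j y))) (Q j.2.2 : Measure (ProbabilityMeasure X1 × ProbabilityMeasure X2)) :=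
      Integrable.of_bound
        (f.continuous.measurable.comp (hmF.comp (hs j))).aestronglyMeasurable ‖f‖
        (Filter.Eventually.of_forall fun y => f.norm_coe_le_norm _)
    have i2 : Integrable (fun y : ProbabilityMeasure X1 × ProbabilityMeasure X2 => f y.1)
        (Q j.2.2 : Measure (ProbabilityMeasure X1 × ProbabilityMeasure X2)) :=
      Integrable.of_bound
        (f.continuous.measurable.comp measurable_fst).aestronglyMeasurable ‖f‖
        (Filter.Eventually.of_forall fun y => f.norm_coe_le_norm _)
    rw [e1, e2, ← integral_sub i1 i2]
    refine (norm_integral_le_of_norm_le_const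
      (Filter.Eventually.of_forall fun y => hs4 j f hj y)).trans ?_
    simp
  have hM2 : Filter.Tendsto (fun j => (P j).map hmS.aemeasurable) U (𝓝 M2) := by
    rw [ProbabilityMeasure.tendsto_iff_forall_integral_tendsto]
    intro f
    rw [tendsto_iff_norm_sub_tendsto_zero]
    refine squeeze_zero' (Filter.Eventually.of_forall fun _ => norm_nonneg _) ?_ hnr
    have hev : ∀ᶠ j : J in U, f ∈ j.2.1 := by
      refine hU ?_
      filter_upwards [Filter.eventually_ge_atTop ((∅, {f}, 0) : J)] with j hj
      exact hj.2.1 (Finset.mem_singleton_self f)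
    filter_upwards [hev] with j hj
    have e1 : ∫ μ, f μ ∂((P j).map hmS.aemeasurable : Measure (ProbabilityMeasure X2))
        = ∫ y, f (margSnd (s j y)) ∂(Q j.2.2 : Measure (ProbabilityMeasure X1 × ProbabilityMeasure X2)) := by
      rw [ProbabilityMeasure.toMeasure_map, hPm, Measure.map_map hmS (hs j),
        integral_map (hmS.comp (hs j)).aemeasurable
          f.continuous.measurable.aestronglyMeasurable]
      rfl
    have e2 : ∫ μ, f μ ∂(M2 : Measure (ProbabilityMeasure X2))
        = ∫ y, f y.2 ∂(Q j.2.2 : Measure (ProbabilityMeasure X1 × ProbabilityMeasure X2)) := by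
      rw [← (hQ j.2.2).2, integral_map measurable_snd.aemeasurable
          f.continuous.measurable.aestronglyMeasurable]
    have i1 : Integrable (fun y => f (margSnd (s j y))) (Q j.2.2 : Measure (ProbabilityMeasure X1 × ProbabilityMeasure X2)) :=
      Integrable.of_bound
        (f.continuous.measurable.comp (hmS.comp (hs j))).aestronglyMeasurable ‖f‖
        (Filter.Eventually.of_forall fun y => f.norm_coe_le_norm _)
    have i2 : Integrable (fun y : ProbabilityMeasure X1 × ProbabilityMeasure X2 => f y.2)
        (Q j.2.2 : Measure (ProbabilityMeasure X1 × ProbabilityMeasure X2)) :=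
      Integrable.of_bound
        (f.continuous.measurable.comp measurable_snd).aestronglyMeasurable ‖f‖
        (Filter.Eventually.of_forall fun y => f.norm_coe_le_norm _)
    rw [e1, e2, ← integral_sub i1 i2]
    refine (norm_integral_le_of_norm_le_const
      (Filter.Eventually.of_forall fun y => hs5 j f hj y)).trans ?_
    simp
  have hL1 : P'.map hmF.aemeasurable = M1 := tendsto_nhds_unique
    (ProbabilityMeasure.tendsto_map_of_tendsto_of_continuous P P' hlim continuous_margFst) hM1
  have hL2 : P'.map hmS.aemeasurable = M2 := tendsto_nhds_unique
    (ProbabilityMeasure.tendsto_map_of_tendsto_of_continuous P P' hlim continuous_margSnd) hM2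
  refine ⟨P', ⟨congrArg Subtype.val hL1, congrArg Subtype.val hL2⟩, ?_⟩
  -- the cost
  refine ENNReal.le_of_forall_pos_le_add fun ε hε _ => ?_
  have hcl := (lsc_lintegral (lsc_transportCost hc)).isClosed_preimage (IterOTCost c M1 M2 + ε)
  have hmem := hcl.mem_of_tendsto hlim (by
    have ht : Filter.Tendsto (fun j : J => 3 * ((j.2.2 : ℝ≥0∞) + 1)⁻¹) U (𝓝 0) := by
      have t0 : Filter.Tendsto (fun n : ℕ => ((n : ℝ≥0∞) + 1)⁻¹) Filter.atTop (𝓝 0) := by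
        have := (Filter.tendsto_add_atTop_iff_nat 1).2 ENNReal.tendsto_inv_nat_nhds_zero
        simpa using this
      have t1 := ENNReal.Tendsto.const_mul (a := 3) t0 (Or.inr (by simp))
      rw [mul_zero] at t1
      exact (t1.comp hN).mono_left hU
    filter_upwards [ht.eventually_le_const (u := (ε : ℝ≥0∞)) (by simpa using hε)] with j hj
    exact (hPc j).trans (by gcongr))
  exact hmem

/-- Lemma 3.2, first part: any random coupling `P ∈ RΓ(M1,M2)` induces a
coupling `Π := (pr¹_♯, pr²_♯)_♯ P ∈ Γ(M1,M2)` with `∫ C dΠ ≤ ∫ (∫ c dπ) dP(π)`; moreover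
`𝒞(M1,M2)` equals the minimum of `∫ (∫ c dπ) dP(π)` over `P ∈ RΓ(M1,M2)`, and this (possibly
infinite) minimum is attained. -/
theorem randCoupling_induces_coupling_and_iter_eq_min
    (c : X1 × X2 → ℝ≥0∞) (hc : LowerSemicontinuous c)
    (M1 : ProbabilityMeasure (ProbabilityMeasure X1))
    (M2 : ProbabilityMeasure (ProbabilityMeasure X2))
    (P : ProbabilityMeasure (ProbabilityMeasure (X1 × X2))) (hP : P ∈ RandCoupling M1 M2) :
    (((P : Measure (ProbabilityMeasure (X1 × X2))).map
        (fun π => (margFst π, margSnd π))).map Prod.fst = (M1 : Measure (ProbabilityMeasure X1))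
      ∧ ((P : Measure (ProbabilityMeasure (X1 × X2))).map
        (fun π => (margFst π, margSnd π))).map Prod.snd = (M2 : Measure (ProbabilityMeasure X2)))
    ∧ (∫⁻ p, OTCost c p.1 p.2
          ∂((P : Measure (ProbabilityMeasure (X1 × X2))).map
              (fun π => (margFst π, margSnd π))))
        ≤ ∫⁻ π, transportCost c π ∂(P : Measure (ProbabilityMeasure (X1 × X2)))
    ∧ IterOTCost c M1 M2
        = ⨅ P' ∈ RandCoupling M1 M2,
            ∫⁻ π, transportCost c π ∂(P' : Measure (ProbabilityMeasure (X1 × X2)))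
    ∧ ∃ P' ∈ RandCoupling M1 M2,
        (∫⁻ π, transportCost c π ∂(P' : Measure (ProbabilityMeasure (X1 × X2))))
          = IterOTCost c M1 M2 := by
  have hmF : Measurable (margFst : ProbabilityMeasure (X1 × X2) → ProbabilityMeasure X1) :=
    continuous_margFst.measurable
  have hmS : Measurable (margSnd : ProbabilityMeasure (X1 × X2) → ProbabilityMeasure X2) :=
    continuous_margSnd.measurable
  have hm : Measurable (fun π : ProbabilityMeasure (X1 × X2) => (margFst π, margSnd π)) :=
    hmF.prodMk hmS
  have hfst : ∀ P' ∈ RandCoupling M1 M2,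
      (((P' : Measure (ProbabilityMeasure (X1 × X2))).map
        (fun π => (margFst π, margSnd π))).map Prod.fst = (M1 : Measure (ProbabilityMeasure X1))
      ∧ ((P' : Measure (ProbabilityMeasure (X1 × X2))).map
        (fun π => (margFst π, margSnd π))).map Prod.snd = (M2 : Measure (ProbabilityMeasure X2))) := by
    intro P' hP'
    refine ⟨?_, ?_⟩
    · rw [Measure.map_map measurable_fst hm]
      exact hP'.1
    · rw [Measure.map_map measurable_snd hm]
      exact hP'.2
  have hle : ∀ P' : ProbabilityMeasure (ProbabilityMeasure (X1 × X2)),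
      (∫⁻ p, OTCost c p.1 p.2
          ∂((P' : Measure (ProbabilityMeasure (X1 × X2))).map
              (fun π => (margFst π, margSnd π))))
        ≤ ∫⁻ π, transportCost c π ∂(P' : Measure (ProbabilityMeasure (X1 × X2))) := by
    intro P'
    exact (lintegral_map_le _ _).trans (lintegral_mono fun π => OTCost_le c π)
  have hge : ∀ P' ∈ RandCoupling M1 M2, IterOTCost c M1 M2
      ≤ ∫⁻ π, transportCost c π ∂(P' : Measure (ProbabilityMeasure (X1 × X2))) := by
    intro P' hP'
    refine le_trans ?_ (hle P')
    exact iInf₂_le (P'.map hm.aemeasurable) (hfst P' hP')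
  have hex : ∃ P' ∈ RandCoupling M1 M2,
        (∫⁻ π, transportCost c π ∂(P' : Measure (ProbabilityMeasure (X1 × X2))))
          = IterOTCost c M1 M2 := by
    by_cases hI : IterOTCost c M1 M2 = ∞
    · exact ⟨P, hP, le_antisymm (by rw [hI]; exact le_top) (hge P hP)⟩
    · obtain ⟨P', hP', h⟩ := exists_optimal c hc M1 M2 hI
      exact ⟨P', hP', le_antisymm h (hge P' hP')⟩
  refine ⟨hfst P hP, hle P, ?_, hex⟩
  apply le_antisymm
  · exact le_iInf₂ hge
  · obtain ⟨P', hP', h⟩ := hex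
    rw [← h]
    exact iInf₂_le P' hP'

end OTRM
end
end

section
/- Let φ1 : P_{a1}(X1) → [−∞,+∞) be C-concave and not identically −∞. Then the total C-superdifferential is characterized as ∂⁺_{t,C} φ1 = { π ∈ P_{a1⊕a2}(X1×X2) : π is a c-optimal coupling between its marginals pr¹_♯π and pr²_♯π, and (pr¹_♯π, pr²_♯π) ∈ ∂⁺_C φ1 }. In particular every π ∈ ∂⁺_{t,C} φ1 is c-optimal and (pr¹_♯, pr²_♯)(∂⁺_{t,C} φ1) = ∂⁺_C φ1. -/
open MeasureTheory Topology ENNReal Set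

noncomputable section

namespace OTRM

variable {X1 X2 : Type*}
  [MeasurableSpace X1] [TopologicalSpace X1] [BorelSpace X1] [PolishSpace X1]
  [MeasurableSpace X2] [TopologicalSpace X2] [BorelSpace X2] [PolishSpace X2]

/-- The pair-marginal pushforward `(pr¹_♯, pr²_♯)_♯ P` of a random coupling. -/
def margPairLaw (P : ProbabilityMeasure (ProbabilityMeasure (X1 × X2))) :
    Measure (ProbabilityMeasure X1 × ProbabilityMeasure X2) :=
  (P : Measure (ProbabilityMeasure (X1 × X2))).map fun π => (margFst π, margSnd π)

/-- The set of `c`-optimal couplings (between their own marginals). -/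
def OptPlans (c : X1 × X2 → ℝ≥0∞) : Set (ProbabilityMeasure (X1 × X2)) :=
  {π | transportCost c π = OTCost c (margFst π) (margSnd π)}

/-- Probability measures with finite `a`-moment: `P_a(X)`. -/
def Pa {X : Type*} [MeasurableSpace X] (a : X → ℝ≥0∞) : Set (ProbabilityMeasure X) :=
  {μ | (∫⁻ x, a x ∂(μ : Measure X)) ≠ ⊤}

/-- Plans both of whose marginals have finite moments: `P_{a1 ⊕ a2}(X1 × X2)`. -/
def PaPair (a1 : X1 → ℝ≥0∞) (a2 : X2 → ℝ≥0∞) : Set (ProbabilityMeasure (X1 × X2)) :=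
  {π | margFst π ∈ Pa a1 ∧ margSnd π ∈ Pa a2}

section Kframework

variable {Y1 Y2 : Type*}

/-- `K`-concavity of `φ` relative to the domains `D1`, `D2` (Definition 2.2(2)):
`φ` is not identically `-∞` on `D1` and is, on `D1`, an infimum of functions
`y1 ↦ K(y1,y2) - α` with `y2 ∈ D2`, `α ∈ ℝ`. -/
def KConcaveOn (K : Y1 → Y2 → ℝ≥0∞) (D1 : Set Y1) (D2 : Set Y2) (φ : Y1 → EReal) : Prop :=
  (∃ y1 ∈ D1, φ y1 ≠ ⊥) ∧
    ∃ A : Set (Y2 × ℝ), (∀ p ∈ A, p.1 ∈ D2) ∧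
      ∀ y1 ∈ D1, φ y1 = ⨅ p ∈ A, ((K y1 p.1 : EReal) - (p.2 : EReal))

/-- The `K`-transform of `φ` (Definition 2.2(3)). -/
def KTransform (K : Y1 → Y2 → ℝ≥0∞) (D1 : Set Y1) (φ : Y1 → EReal) : Y2 → EReal :=
  fun y2 => ⨅ y1 ∈ D1, ((K y1 y2 : EReal) - φ y1)

/-- The `K`-superdifferential of `φ` (Definition 2.2(4)). -/
def KSuperdiff (K : Y1 → Y2 → ℝ≥0∞) (D1 : Set Y1) (D2 : Set Y2) (φ : Y1 → EReal) :
    Set (Y1 × Y2) :=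
  {p | p.1 ∈ D1 ∧ p.2 ∈ D2 ∧ φ p.1 ≠ ⊥ ∧
    ∀ y1' ∈ D1, ((K p.1 p.2 : EReal) - φ p.1) ≤ ((K y1' p.2 : EReal) - φ y1')}

/-- `K`-cyclical monotonicity of a set of pairs (Definition 2.2(1)). -/
def KCyclMono (K : Y1 → Y2 → ℝ≥0∞) (G : Set (Y1 × Y2)) : Prop :=
  ∀ (k : ℕ), 1 ≤ k → ∀ f : Fin k → Y1 × Y2, (∀ i, f i ∈ G) →
    ∀ σ : Equiv.Perm (Fin k), (∑ i, K (f i).1 (f i).2) ≤ ∑ i, K (f i).1 (f (σ i)).2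

end Kframework

/-- First marginal of a measure on `X1 × X2 × X1`. -/
def margFirst3 (θ : ProbabilityMeasure (X1 × X2 × X1)) : ProbabilityMeasure X1 :=
  θ.map measurable_fst.aemeasurable

/-- Third marginal of a measure on `X1 × X2 × X1`. -/
def margThird3 (θ : ProbabilityMeasure (X1 × X2 × X1)) : ProbabilityMeasure X1 :=
  θ.map (measurable_snd.comp measurable_snd).aemeasurable

/-- The total `C`-superdifferential of `φ` (Definition 3.4). -/
def TotalSuperdiff (c : X1 × X2 → ℝ≥0∞) (a1 : X1 → ℝ≥0∞) (a2 : X2 → ℝ≥0∞)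
    (φ : ProbabilityMeasure X1 → EReal) : Set (ProbabilityMeasure (X1 × X2)) :=
  {π | π ∈ PaPair a1 a2 ∧
    ∀ θ : ProbabilityMeasure (X1 × X2 × X1),
      (θ : Measure (X1 × X2 × X1)).map (fun p => (p.1, p.2.1)) = (π : Measure (X1 × X2)) →
      margThird3 θ ∈ Pa a1 →
      ((∫⁻ p, c (p.1, p.2.1) ∂(θ : Measure (X1 × X2 × X1)) : ℝ≥0∞) : EReal)
          - ((∫⁻ p, c (p.2.2, p.2.1) ∂(θ : Measure (X1 × X2 × X1)) : ℝ≥0∞) : EReal)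
        ≤ φ (margFirst3 θ) - φ (margThird3 θ)}

/-- Total `C`-cyclical monotonicity of a set of plans (Definition 3.5). -/
def TotallyCCyclMono (c : X1 × X2 → ℝ≥0∞) (F : Set (ProbabilityMeasure (X1 × X2))) : Prop :=
  ∀ (N : ℕ), 1 ≤ N → ∀ θ : ProbabilityMeasure (Fin N → X1 × X2),
    (∀ n : Fin N, θ.map (measurable_pi_apply n).aemeasurable ∈ F) →
    ∀ σ : Equiv.Perm (Fin N),
      (∫⁻ ω, ∑ i, c (ω i) ∂(θ : Measure (Fin N → X1 × X2)))
        ≤ ∫⁻ ω, ∑ i, c ((ω i).1, (ω (σ i)).2) ∂(θ : Measure (Fin N → X1 × X2))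


lemma ereal_aux {s t : ℝ≥0∞} {p q : EReal} (hs : s ≠ ⊤) (ht : t ≠ ⊤) (hp : p ≠ ⊥) (hp' : p ≠ ⊤)
    (hq : q ≠ ⊤) :
    ((s : EReal) - (t : EReal) ≤ p - q) ↔ ((s : EReal) - p ≤ (t : EReal) - q) := by
  lift s to NNReal using hs
  lift t to NNReal using ht
  lift p to ℝ using ⟨hp', hp⟩
  induction q with
  | bot => simp [sub_eq_add_neg]
  | top => exact absurd rfl hq
  | coe q =>
    have e1 : (((s : ℝ≥0∞)) : EReal) = ((s : ℝ) : EReal) := rfl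
    have e2 : (((t : ℝ≥0∞)) : EReal) = ((t : ℝ) : EReal) := rfl
    rw [e1, e2]
    norm_cast
    constructor <;> intro h <;> linarith

lemma bdd_lsc {X : Type*} [MeasurableSpace X] [TopologicalSpace X] [BorelSpace X] [PolishSpace X]
    (f : X → ℝ) (hf0 : 0 ≤ f) (hf : LowerSemicontinuous f) :
    LowerSemicontinuous (fun π : ProbabilityMeasure X =>
      ∫⁻ x, ENNReal.ofReal (f x) ∂(π : Measure X)) := by
  rw [lowerSemicontinuous_iff_isClosed_preimage]
  intro y
  apply IsSeqClosed.isClosed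
  intro μs μ hμs hlim
  have h1 : ∫⁻ x, ENNReal.ofReal (f x) ∂(μ : Measure X) ≤
      Filter.atTop.liminf (fun i => ∫⁻ x, ENNReal.ofReal (f x) ∂(μs i : Measure X)) := by
    simp_rw [lintegral_eq_lintegral_meas_lt _ (Filter.Eventually.of_forall hf0)
      hf.measurable.aemeasurable]
    refine (lintegral_mono (fun t => ?_)).trans (lintegral_liminf_le (fun n =>
      Antitone.measurable (fun s t hst => measure_mono (fun ω hω => lt_of_le_of_lt hst hω))))
    exact ProbabilityMeasure.le_liminf_measure_open_of_tendsto hlim (hf.isOpen_preimage t)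
  refine h1.trans ?_
  refine Filter.liminf_le_of_frequently_le' ?_
  exact Filter.Frequently.of_forall hμs

lemma cost_lsc {X : Type*} [MeasurableSpace X] [TopologicalSpace X] [BorelSpace X] [PolishSpace X]
    (c : X → ℝ≥0∞) (hc : LowerSemicontinuous c) :
    LowerSemicontinuous (fun π : ProbabilityMeasure X => ∫⁻ x, c x ∂(π : Measure X)) := by
  have hfin : ∀ (n : ℕ) x, min (c x) (n : ℝ≥0∞) ≠ ⊤ := fun n x =>
    ne_top_of_le_ne_top (ENNReal.natCast_ne_top n) (min_le_right _ _)
  have hl : ∀ n : ℕ, LowerSemicontinuous (fun x => (min (c x) (n : ℝ≥0∞)).toReal) := by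
    intro n x y hy
    rcases lt_or_ge y 0 with h | h
    · exact Filter.Eventually.of_forall fun x' => h.trans_le ENNReal.toReal_nonneg
    · have hy' : ENNReal.ofReal y < min (c x) (n : ℝ≥0∞) :=
        (ENNReal.ofReal_lt_iff_lt_toReal h (hfin n x)).2 hy
      rw [lt_min_iff] at hy'
      filter_upwards [hc x _ hy'.1] with x' hx'
      exact (ENNReal.ofReal_lt_iff_lt_toReal h (hfin n x')).1 (lt_min hx' hy'.2)
  have hsup : ∀ x, c x = ⨆ n : ℕ, ENNReal.ofReal (min (c x) (n : ℝ≥0∞)).toReal := by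
    intro x
    simp_rw [ENNReal.ofReal_toReal (hfin _ x)]
    apply le_antisymm
    · rw [← inf_iSup_eq, ENNReal.iSup_natCast]; simp
    · exact iSup_le fun n => min_le_left _ _
  have : (fun π : ProbabilityMeasure X => ∫⁻ x, c x ∂(π : Measure X)) =
      fun π : ProbabilityMeasure X => ⨆ n : ℕ,
        ∫⁻ x, ENNReal.ofReal (min (c x) (n : ℝ≥0∞)).toReal ∂(π : Measure X) := by
    funext π
    rw [← lintegral_iSup]
    · exact lintegral_congr hsup
    · exact fun n => ((hl n).measurable).ennreal_ofReal
    · intro m n hmn x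
      apply ENNReal.ofReal_le_ofReal
      apply ENNReal.toReal_mono (hfin n x)
      exact min_le_min le_rfl (by exact_mod_cast hmn)
  rw [this]
  exact lowerSemicontinuous_iSup fun n => bdd_lsc _ (fun x => ENNReal.toReal_nonneg) (hl n)

lemma mem_coupling_iff (μ1 : ProbabilityMeasure X1) (μ2 : ProbabilityMeasure X2)
    (π : ProbabilityMeasure (X1 × X2)) :
    π ∈ Coupling μ1 μ2 ↔ margFst π = μ1 ∧ margSnd π = μ2 := by
  simp only [Coupling, margFst, margSnd, Set.mem_ofPred_eq]
  constructor
  · rintro ⟨h1, h2⟩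
    exact ⟨Subtype.ext h1, Subtype.ext h2⟩
  · rintro ⟨rfl, rfl⟩
    exact ⟨rfl, rfl⟩

lemma exists_opt (c : X1 × X2 → ℝ≥0∞) (hc : LowerSemicontinuous c)
    (μ1 : ProbabilityMeasure X1) (μ2 : ProbabilityMeasure X2) :
    ∃ π ∈ Coupling μ1 μ2, transportCost c π = OTCost c μ1 μ2 := by
  have hclosed : IsClosed (Coupling μ1 μ2) := by
    have : Coupling μ1 μ2 = (margFst ⁻¹' {μ1}) ∩ (margSnd ⁻¹' {μ2}) := by
      ext π; exact mem_coupling_iff μ1 μ2 π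
    rw [this]
    exact (isClosed_singleton.preimage (ProbabilityMeasure.continuous_map continuous_fst)).inter
      (isClosed_singleton.preimage (ProbabilityMeasure.continuous_map continuous_snd))
  have htight : IsTightMeasureSet
      {((μ : ProbabilityMeasure (X1 × X2)) : Measure (X1 × X2)) | μ ∈ Coupling μ1 μ2} := by
    apply IsTightMeasureSet.prodMk
    · refine (isTightMeasureSet_singleton (μ := (μ1 : Measure X1))).subset ?_
      rintro _ ⟨_, ⟨π, hπ, rfl⟩, rfl⟩
      exact hπ.1
    · refine (isTightMeasureSet_singleton (μ := (μ2 : Measure X2))).subset ?_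
      rintro _ ⟨_, ⟨π, hπ, rfl⟩, rfl⟩
      exact hπ.2
  have hcomp : IsCompact (Coupling μ1 μ2) := by
    have := isCompact_closure_of_isTightMeasureSet htight
    rwa [hclosed.closure_eq] at this
  have hne : (Coupling μ1 μ2).Nonempty := by
    refine ⟨⟨(μ1 : Measure X1).prod (μ2 : Measure X2), inferInstance⟩, ?_, ?_⟩
    · simp [Measure.map_fst_prod]
    · simp [Measure.map_snd_prod]
  obtain ⟨π, hπ, hmin⟩ := LowerSemicontinuousOn.exists_isMinOn hne hcomp
    ((cost_lsc c hc).lowerSemicontinuousOn _)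
  refine ⟨π, hπ, le_antisymm (le_iInf₂ fun π' hπ' => hmin hπ') (iInf₂_le π hπ)⟩

lemma cost_fin (c : X1 × X2 → ℝ≥0∞)
    (a1 : X1 → ℝ≥0∞) (a2 : X2 → ℝ≥0∞) (ha1 : Measurable a1) (ha2 : Measurable a2)
    (hdom : ∀ x1 x2, c (x1, x2) ≤ a1 x1 + a2 x2) (π : ProbabilityMeasure (X1 × X2))
    (h1 : margFst π ∈ Pa a1) (h2 : margSnd π ∈ Pa a2) : transportCost c π ≠ ⊤ := by
  have e1 : ∫⁻ x, a1 x ∂(margFst π : Measure X1) = ∫⁻ p, a1 p.1 ∂(π : Measure (X1 × X2)) :=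
    lintegral_map ha1 measurable_fst
  have e2 : ∫⁻ x, a2 x ∂(margSnd π : Measure X2) = ∫⁻ p, a2 p.2 ∂(π : Measure (X1 × X2)) :=
    lintegral_map ha2 measurable_snd
  have h1' : ∫⁻ p, a1 p.1 ∂(π : Measure (X1 × X2)) ≠ ⊤ := e1 ▸ h1
  have h2' : ∫⁻ p, a2 p.2 ∂(π : Measure (X1 × X2)) ≠ ⊤ := e2 ▸ h2
  refine ne_top_of_le_ne_top (ENNReal.add_ne_top.2 ⟨h1', h2'⟩) ?_
  rw [← lintegral_add_left (by fun_prop : Measurable fun p : X1 × X2 => a1 p.1)]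
  exact lintegral_mono fun p => hdom p.1 p.2

lemma glue (π π' : ProbabilityMeasure (X1 × X2)) (h : margSnd π = margSnd π') :
    ∃ θ : ProbabilityMeasure (X1 × X2 × X1),
      (θ : Measure (X1 × X2 × X1)).map (fun p => (p.1, p.2.1)) = (π : Measure (X1 × X2)) ∧
      (θ : Measure (X1 × X2 × X1)).map (fun p => (p.2.2, p.2.1)) = (π' : Measure (X1 × X2)) := by
  have : Nonempty (X1 × X2) := π.nonempty
  have : Nonempty X1 := this.map Prod.fst
  let ρ : Measure (X2 × X1) := (π' : Measure (X1 × X2)).map Prod.swap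
  have : IsProbabilityMeasure ρ := Measure.isProbabilityMeasure_map measurable_swap.aemeasurable
  let κ : ProbabilityTheory.Kernel X2 X1 := ρ.condKernel
  let κ' : ProbabilityTheory.Kernel (X1 × X2) X1 := κ.comap Prod.snd measurable_snd
  let m : Measure ((X1 × X2) × X1) := (π : Measure (X1 × X2)).compProd κ'
  have hm : Measurable (fun p : (X1 × X2) × X1 => (p.1.1, p.1.2, p.2)) := by fun_prop
  have hρ : ρ.fst = (π : Measure (X1 × X2)).map Prod.snd := by
    have h' : (π : Measure (X1 × X2)).map Prod.snd = (π' : Measure (X1 × X2)).map Prod.snd :=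
      congrArg Subtype.val h
    rw [h']
    simp only [ρ, Measure.fst]
    rw [Measure.map_map measurable_fst measurable_swap]
    rfl
  refine ⟨⟨m.map (fun p => (p.1.1, p.1.2, p.2)),
    Measure.isProbabilityMeasure_map hm.aemeasurable⟩, ?_, ?_⟩
  · change (m.map _).map _ = _
    rw [Measure.map_map (by fun_prop) hm]
    change m.fst = _
    exact Measure.fst_compProd _ _
  · change (m.map _).map _ = _
    rw [Measure.map_map (by fun_prop) hm]
    have key : m.map (fun p => (p.1.2, p.2)) = ρ := by
      conv_rhs => rw [← ρ.disintegrate κ, hρ]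
      ext s hs
      rw [Measure.map_apply (by fun_prop) hs,
        Measure.compProd_apply (hs.preimage (by fun_prop)),
        Measure.compProd_apply hs, lintegral_map
          (ProbabilityTheory.Kernel.measurable_kernel_prodMk_left hs) measurable_snd]
      rfl
    have e : ((fun p : X1 × X2 × X1 => (p.2.2, p.2.1)) ∘
        (fun p : (X1 × X2) × X1 => (p.1.1, p.1.2, p.2))) =
        Prod.swap ∘ (fun p : (X1 × X2) × X1 => (p.1.2, p.2)) := rfl
    rw [e, ← Measure.map_map measurable_swap (by fun_prop), key]
    simp only [ρ]
    rw [Measure.map_map measurable_swap measurable_swap]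
    simp

/-- Data read off from a three-plan `θ`. -/
lemma theta_data (c : X1 × X2 → ℝ≥0∞) (hc : LowerSemicontinuous c)
    (θ : ProbabilityMeasure (X1 × X2 × X1)) (π π' : ProbabilityMeasure (X1 × X2))
    (h1 : (θ : Measure (X1 × X2 × X1)).map (fun p => (p.1, p.2.1)) = (π : Measure (X1 × X2)))
    (h2 : (θ : Measure (X1 × X2 × X1)).map (fun p => (p.2.2, p.2.1)) = (π' : Measure (X1 × X2))) :
    margFirst3 θ = margFst π ∧ margThird3 θ = margFst π' ∧ margSnd π' = margSnd π ∧
    ∫⁻ p, c (p.1, p.2.1) ∂(θ : Measure (X1 × X2 × X1)) = transportCost c π ∧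
    ∫⁻ p, c (p.2.2, p.2.1) ∂(θ : Measure (X1 × X2 × X1)) = transportCost c π' := by
  refine ⟨Subtype.ext ?_, Subtype.ext ?_, Subtype.ext ?_, ?_, ?_⟩
  · change Measure.map _ (θ : Measure (X1 × X2 × X1)) = Measure.map _ (π : Measure (X1 × X2))
    rw [← h1, Measure.map_map (by fun_prop) (by fun_prop)]
    rfl
  · change Measure.map _ (θ : Measure (X1 × X2 × X1)) = Measure.map _ (π' : Measure (X1 × X2))
    rw [← h2, Measure.map_map (by fun_prop) (by fun_prop)]
    rfl
  · change Measure.map _ (π' : Measure (X1 × X2)) = Measure.map _ (π : Measure (X1 × X2))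
    rw [← h1, ← h2, Measure.map_map (by fun_prop) (by fun_prop),
      Measure.map_map (by fun_prop) (by fun_prop)]
    rfl
  · rw [transportCost, ← h1, lintegral_map hc.measurable (by fun_prop)]
  · rw [transportCost, ← h2, lintegral_map hc.measurable (by fun_prop)]

/-- Proposition 3.6, claim 1: for a `C`-concave `φ` (not identically `-∞`),
the total `C`-superdifferential consists exactly of those plans `π ∈ P_{a1⊕a2}` that are
`c`-optimal between their marginals and whose marginal pair lies in `∂⁺_C φ`. In particular,
every `π ∈ ∂⁺_{t,C} φ` is `c`-optimal and the marginal-pair image of `∂⁺_{t,C} φ` is `∂⁺_C φ`. -/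
theorem totalSuperdiff_eq
    (c : X1 × X2 → ℝ≥0∞) (hc : LowerSemicontinuous c)
    (a1 : X1 → ℝ≥0∞) (a2 : X2 → ℝ≥0∞) (ha1 : Measurable a1) (ha2 : Measurable a2)
    (hdom : ∀ x1 x2, c (x1, x2) ≤ a1 x1 + a2 x2)
    (φ : ProbabilityMeasure X1 → EReal) (hφtop : ∀ μ ∈ Pa a1, φ μ ≠ ⊤)
    (hφ : KConcaveOn (OTCost c) (Pa a1) (Pa a2) φ) :
    TotalSuperdiff c a1 a2 φ =
        {π | π ∈ PaPair a1 a2 ∧ π ∈ OptPlans c ∧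
          (margFst π, margSnd π) ∈ KSuperdiff (OTCost c) (Pa a1) (Pa a2) φ}
      ∧ (∀ π ∈ TotalSuperdiff c a1 a2 φ, π ∈ OptPlans c)
      ∧ (fun π => (margFst π, margSnd π)) '' TotalSuperdiff c a1 a2 φ
          = KSuperdiff (OTCost c) (Pa a1) (Pa a2) φ := by
  have hmain : TotalSuperdiff c a1 a2 φ =
        {π | π ∈ PaPair a1 a2 ∧ π ∈ OptPlans c ∧
          (margFst π, margSnd π) ∈ KSuperdiff (OTCost c) (Pa a1) (Pa a2) φ} := by
    ext π
    constructor
    · rintro ⟨hπ, hT⟩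
      have hfin := cost_fin c a1 a2 ha1 ha2 hdom π hπ.1 hπ.2
      have key : ∀ π' : ProbabilityMeasure (X1 × X2), margFst π' ∈ Pa a1 →
          margSnd π = margSnd π' →
          (transportCost c π : EReal) - (transportCost c π' : EReal)
            ≤ φ (margFst π) - φ (margFst π') := by
        intro π' hπ' hs
        obtain ⟨θ, h1, h2⟩ := glue π π' hs
        obtain ⟨e1, e2, -, e3, e4⟩ := theta_data c hc θ π π' h1 h2
        have := hT θ h1 (e2 ▸ hπ')
        rwa [e1, e2, e3, e4] at this
      have hbot : φ (margFst π) ≠ ⊥ := by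
        intro hb
        have := key π hπ.1 rfl
        rw [hb] at this
        lift transportCost c π to NNReal using hfin with t
        have e1 : (((t : ℝ≥0∞)) : EReal) = ((t : ℝ) : EReal) := rfl
        rw [e1, ← EReal.coe_sub] at this
        simp at this
      have htop := hφtop _ hπ.1
      have key2 : ∀ μ ∈ Pa a1, (transportCost c π : EReal) - φ (margFst π)
          ≤ (OTCost c μ (margSnd π) : EReal) - φ μ := by
        intro μ hμ
        obtain ⟨π', hπ', ho⟩ := exists_opt c hc μ (margSnd π)
        obtain ⟨g1, g2⟩ := (mem_coupling_iff _ _ _).1 hπ'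
        have hk := key π' (g1 ▸ hμ) g2.symm
        have hf' := cost_fin c a1 a2 ha1 ha2 hdom π' (g1 ▸ hμ) (g2 ▸ hπ.2)
        rw [g1] at hk
        rw [← ho]
        exact (ereal_aux hfin hf' hbot htop (hφtop _ hμ)).1 hk
      have hle : OTCost c (margFst π) (margSnd π) ≤ transportCost c π :=
        iInf₂_le π ((mem_coupling_iff _ _ _).2 ⟨rfl, rfl⟩)
      have hopt : transportCost c π = OTCost c (margFst π) (margSnd π) := by
        refine le_antisymm ?_ hle
        have := (ereal_aux hfin (ne_top_of_le_ne_top hfin hle) hbot htop htop).2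
          (key2 _ hπ.1)
        rw [EReal.sub_self htop hbot] at this
        exact_mod_cast EReal.sub_nonpos.1 this
      refine ⟨hπ, hopt, hπ.1, hπ.2, hbot, fun μ hμ => ?_⟩
      have := key2 μ hμ
      rwa [hopt] at this
    · rintro ⟨hπ, hopt, -, -, hbot, hsup⟩
      refine ⟨hπ, fun θ h1 h3 => ?_⟩
      let π' : ProbabilityMeasure (X1 × X2) :=
        θ.map (f := fun p => (p.2.2, p.2.1)) (by fun_prop)
      obtain ⟨e1, e2, e5, e3, e4⟩ := theta_data c hc θ π π' h1 rfl
      rw [e2] at h3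
      rw [e1, e2, e3, e4]
      have hfin := cost_fin c a1 a2 ha1 ha2 hdom π hπ.1 hπ.2
      have hfin' := cost_fin c a1 a2 ha1 ha2 hdom π' h3 (e5 ▸ hπ.2)
      refine (ereal_aux hfin hfin' hbot (hφtop _ hπ.1) (hφtop _ h3)).2 ?_
      have hs := hsup _ h3
      have hopt' : transportCost c π = OTCost c (margFst π) (margSnd π) := hopt
      rw [hopt']
      refine hs.trans (EReal.sub_le_sub ?_ le_rfl)
      have hle : OTCost c (margFst π') (margSnd π) ≤ transportCost c π' :=
        iInf₂_le π' ((mem_coupling_iff _ _ _).2 ⟨rfl, e5⟩)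
      exact_mod_cast hle
  refine ⟨hmain, fun π hπ => ?_, ?_⟩
  · rw [hmain] at hπ
    exact hπ.2.1
  · rw [hmain]
    ext ⟨μ1, μ2⟩
    constructor
    · rintro ⟨π, hπ, h⟩
      rw [← h]
      exact hπ.2.2
    · intro h
      obtain ⟨π, hπ, ho⟩ := exists_opt c hc μ1 μ2
      obtain ⟨g1, g2⟩ := (mem_coupling_iff _ _ _).1 hπ
      subst g1 g2
      exact ⟨π, ⟨⟨h.1, h.2.1⟩, ho, h⟩, rfl⟩

end OTRM
end
end
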